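/- arXiv:2003.05779 — 7 statements merged into one kernel-verified Lean document; each statement's English description precedes it below -/
import Mathlib

section
/- Let G=(V,U,D) be a simple mixed graph (V possibly infinite). If G is vertex-balanced but not edge-balanced, then G contains a directed cycle or a bi-infinite directed path. -/
/-- The successor of index `l` in a cyclic sequence of length `k` (i.e., `l + 1 mod k`). -/
def cycNext {k : ℕ} (l : Fin k) : Fin k := ⟨(l.val + 1) % k, Nat.mod_lt _ l.pos⟩

/-- A directed cycle for the relation `D`: a sequence of `k ≥ 3` pairwise distinct
vertices `v_0, …, v_{k-1}` with `D (v_l) (v_{l+1 mod k})` for all `l`. -/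
def HasDirectedCycle {V : Type*} (D : V → V → Prop) : Prop :=
  ∃ (k : ℕ) (f : Fin k → V), 3 ≤ k ∧ Function.Injective f ∧ ∀ l, D (f l) (f (cycNext l))

/-- A bi-infinite directed path for the relation `D`: an injective map `f : ℤ → V`
with `D (f n) (f (n+1))` for all `n`. -/
def HasBiInfiniteDirectedPath {V : Type*} (D : V → V → Prop) : Prop :=
  ∃ f : ℤ → V, Function.Injective f ∧ ∀ n : ℤ, D (f n) (f (n + 1))

theorem exists_biwalk {V : Type*} (D : V → V → Prop)
    (hb : ∀ v, (∃ v', D v' v) ↔ (∃ v'', D v v''))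
    (hne : ∃ v w, D v w) : ∃ f : ℤ → V, ∀ n : ℤ, D (f n) (f (n + 1)) := by
  obtain ⟨v0, hv0⟩ := hne
  have hs : ∀ x : {v // ∃ w, D v w}, ∃ y : {v // ∃ w, D v w}, D x.1 y.1 := by
    rintro ⟨v, w, hw⟩
    exact ⟨⟨w, (hb w).1 ⟨v, hw⟩⟩, hw⟩
  have hp : ∀ x : {v // ∃ w, D v w}, ∃ y : {v // ∃ w, D v w}, D y.1 x.1 := by
    rintro ⟨v, hv⟩
    obtain ⟨u, hu⟩ := (hb v).2 hv
    exact ⟨⟨u, v, hu⟩, hu⟩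
  choose s hs using hs
  choose p hp using hp
  let x0 : {v // ∃ w, D v w} := ⟨v0, hv0⟩
  let f : ℤ → V := fun n => match n with
    | Int.ofNat n => (s^[n] x0).1
    | Int.negSucc n => (p^[n+1] x0).1
  refine ⟨f, fun n => ?_⟩
  match n with
  | Int.ofNat n =>
    change D (s^[n] x0).1 (s^[n+1] x0).1
    rw [Function.iterate_succ_apply']
    exact hs _
  | Int.negSucc 0 => exact hp x0
  | Int.negSucc (n+1) =>
    change D (p^[n+1+1] x0).1 (p^[n+1] x0).1
    rw [Function.iterate_succ_apply' p (n+1)]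
    exact hp _

/-- A simple mixed graph (possibly infinite) that is vertex-balanced but not edge-balanced
contains a directed cycle or a bi-infinite directed path. -/
theorem stmt_2 {V : Type*} (U D : V → V → Prop)
    (hU_irrefl : ∀ v, ¬ U v v)
    (hU_symm : ∀ v w, U v w → U w v)
    (hD_irrefl : ∀ v, ¬ D v v)
    (hUD : ∀ v w, ¬ (U v w ∧ D v w))
    (hUD' : ∀ v w, ¬ (U v w ∧ D w v))
    (hDD : ∀ v w, ¬ (D v w ∧ D w v))
    (h_vertex_balanced : ∀ v, (∃ v', D v' v) ↔ (∃ v'', D v v''))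
    (h_not_edge_balanced : ∃ v w, D v w) :
    HasDirectedCycle D ∨ HasBiInfiniteDirectedPath D := by
  obtain ⟨f, hf⟩ := exists_biwalk D h_vertex_balanced h_not_edge_balanced
  by_cases hinj : Function.Injective f
  · exact Or.inr ⟨f, hinj, hf⟩
  left
  have hex : ∃ k : ℕ, 0 < k ∧ ∃ i : ℤ, f i = f (i + k) := by
    simp only [Function.Injective, not_forall] at hinj
    obtain ⟨a, b, hab, hne⟩ := hinj
    rcases lt_or_gt_of_ne hne with h | h
    · exact ⟨(b - a).toNat, by omega, a, by
        rw [show a + ((b - a).toNat : ℤ) = b by omega]; exact hab⟩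
    · exact ⟨(a - b).toNat, by omega, b, by
        rw [show b + ((a - b).toNat : ℤ) = a by omega]; exact hab.symm⟩
  classical
  obtain ⟨hk, i, hi⟩ := Nat.find_spec hex
  have hmin := fun m (hm : m < Nat.find hex) => Nat.find_min hex hm
  generalize Nat.find hex = k at hk hi hmin
  refine ⟨k, fun l => f (i + (l.val : ℤ)), ?_, ?_, ?_⟩
  · by_contra hlt
    have h12 : k = 1 ∨ k = 2 := by omega
    rcases h12 with rfl | rfl
    · have := hf i
      rw [show f (i + 1) = f i from by simpa using hi.symm] at this
      exact hD_irrefl _ this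
    · have h1 := hf i
      have h2 := hf (i + 1)
      rw [show i + 1 + 1 = i + ((2 : ℕ) : ℤ) by push_cast; ring, ← hi] at h2
      exact hDD _ _ ⟨h1, h2⟩
  · have key : ∀ a b : ℕ, a < b → b < k → f (i + a) ≠ f (i + b) := by
      intro a b hab hbk h
      refine hmin (b - a) (by omega) ⟨by omega, i + a, ?_⟩
      rw [h]
      congr 1
      omega
    intro a b hab
    rcases lt_trichotomy a.val b.val with h | h | h
    · exact absurd hab (key _ _ h b.2)
    · exact Fin.ext h
    · exact absurd hab.symm (key _ _ h a.2)
  · intro l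
    have h := hf (i + (l.val : ℤ))
    by_cases hl : l.val + 1 = k
    · have : (cycNext l).val = 0 := by simp [cycNext, hl]
      simp only [this]
      rw [show i + (l.val : ℤ) + 1 = i + (k : ℤ) by omega, ← hi] at h
      simpa using h
    · have : (cycNext l).val = l.val + 1 := Nat.mod_eq_of_lt (by omega)
      simp only [this]
      rw [show i + (l.val : ℤ) + 1 = i + ((l.val + 1 : ℕ) : ℤ) by push_cast; ring] at h
      exact h
end

section
/- Let G=(V,U,D) be a simple mixed graph (V possibly infinite). If G is vertex-balanced and contains no directed cycle and no bi-infinite directed path, then G is edge-balanced. -/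
/-- A simple mixed graph (possibly infinite) that is vertex-balanced and contains
no directed cycle and no bi-infinite directed path is edge-balanced. -/
theorem stmt_3 {V : Type*} (U D : V → V → Prop)
    (hU_irrefl : ∀ v, ¬ U v v)
    (hU_symm : ∀ v w, U v w → U w v)
    (hD_irrefl : ∀ v, ¬ D v v)
    (hUD : ∀ v w, ¬ (U v w ∧ D v w))
    (hUD' : ∀ v w, ¬ (U v w ∧ D w v))
    (hDD : ∀ v w, ¬ (D v w ∧ D w v))
    (h_vertex_balanced : ∀ v, (∃ v', D v' v) ↔ (∃ v'', D v v''))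
    (h_no_cycle : ¬ HasDirectedCycle D)
    (h_no_path : ¬ HasBiInfiniteDirectedPath D) :
    ∀ v w, ¬ D v w := by
  intro v w hvw
  have hn : ∀ s : {v // ∃ w, D v w}, ∃ t : {v // ∃ w, D v w}, D s.1 t.1 := by
    rintro ⟨a, b, hab⟩
    exact ⟨⟨b, (h_vertex_balanced b).1 ⟨a, hab⟩⟩, hab⟩
  have hp : ∀ s : {v // ∃ w, D v w}, ∃ t : {v // ∃ w, D v w}, D t.1 s.1 := by
    rintro ⟨a, ha⟩
    obtain ⟨b, hb⟩ := (h_vertex_balanced a).2 ha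
    exact ⟨⟨b, a, hb⟩, hb⟩
  choose next hnext using hn
  choose prev hprev using hp
  let s : {v // ∃ w, D v w} := ⟨v, w, hvw⟩
  obtain ⟨f, hf⟩ : ∃ f : ℤ → V, ∀ n : ℤ, D (f n) (f (n + 1)) := by
    refine ⟨fun n => match n with
      | Int.ofNat n => (next^[n] s).1
      | Int.negSucc n => (prev^[n+1] s).1, ?_⟩
    intro n
    match n with
    | Int.ofNat n =>
      change D (next^[n] s).1 (next^[n+1] s).1
      rw [Function.iterate_succ_apply']
      exact hnext _
    | Int.negSucc 0 => exact hprev s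
    | Int.negSucc (n+1) =>
      change D (prev^[n+1+1] s).1 (prev^[n+1] s).1
      rw [Function.iterate_succ_apply' prev (n+1)]
      exact hprev _
  have hex : ∃ k : ℕ, 0 < k ∧ ∃ n : ℤ, f n = f (n + k) := by
    by_contra hcon
    push Not at hcon
    refine h_no_path ⟨f, ?_, hf⟩
    intro a b hab
    by_contra hne
    rcases lt_or_gt_of_ne hne with h | h
    · refine hcon (b - a).toNat (by omega) a ?_
      rw [hab]; congr 1; omega
    · refine hcon (a - b).toNat (by omega) b ?_
      rw [← hab]; congr 1; omega
  classical
  obtain ⟨hk, n, hkn⟩ := Nat.find_spec hex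
  have hmin : ∀ m : ℕ, m < Nat.find hex → 0 < m → ∀ a : ℤ, f a ≠ f (a + m) :=
    fun m hm h0 a h => Nat.find_min hex hm ⟨h0, a, h⟩
  generalize Nat.find hex = k at hk hkn hmin
  have h3 : 3 ≤ k := by
    by_contra hlt
    obtain rfl | rfl : k = 1 ∨ k = 2 := by omega
    · have h := hf n
      push_cast at hkn
      rw [← hkn] at h
      exact hD_irrefl _ h
    · have h1 := hf n
      have h2 := hf (n + 1)
      have e : n + 1 + 1 = n + (2 : ℕ) := by push_cast; ring
      rw [e, ← hkn] at h2
      exact hDD _ _ ⟨h1, h2⟩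
  refine h_no_cycle ⟨k, fun l => f (n + (l.val : ℕ)), h3, ?_, ?_⟩
  · intro a b hab
    have ha := a.2
    have hb := b.2
    simp only at hab
    by_contra hne
    have hne' : a.val ≠ b.val := fun h => hne (Fin.ext h)
    rcases lt_or_gt_of_ne hne' with h | h
    · refine hmin (b.val - a.val) (by omega) (by omega) (n + (a.val : ℕ)) ?_
      rw [hab]; congr 1; omega
    · refine hmin (a.val - b.val) (by omega) (by omega) (n + (b.val : ℕ)) ?_
      rw [← hab]; congr 1; omega
  · intro l
    have hl := l.2
    have h := hf (n + (l.val : ℕ))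
    simp only [cycNext]
    by_cases hlk : l.val + 1 = k
    · rw [hlk, Nat.mod_self]
      have e : n + (l.val : ℕ) + 1 = n + (k : ℕ) := by omega
      rw [e, ← hkn] at h
      simpa using h
    · rw [Nat.mod_eq_of_lt (by omega)]
      have e : n + (l.val : ℕ) + 1 = n + ((l.val + 1 : ℕ) : ℤ) := by omega
      rw [e] at h
      exact h
end

section
/- Let V be a finite set, R an irreflexive symmetric relation on V, and r : V × V → ℝ≥0. Suppose there is a set P ⊆ V of vertices such that for every (i,j) ∈ R, r(i,j) > 0 if and only if i ∈ P (the positivity of each rate is determined by its source vertex, as for mass-action or general kinetics). If r is formally balanced (FB), then r is strongly cycle-balanced (sCycB). -/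
open scoped NNReal

/-- `f : Fin k → V` is a directed cycle for the relation `R`: `k ≥ 3` pairwise distinct
vertices `v_0, …, v_{k-1}` with `R (v_l) (v_{l+1 mod k})` for all `l`. -/
def IsDirCycle {V : Type*} (R : V → V → Prop) {k : ℕ} (f : Fin k → V) : Prop :=
  3 ≤ k ∧ Function.Injective f ∧ ∀ l, R (f l) (f (cycNext l))

/-- `r` is detailed-balanced: `r i j = r j i` for all `(i,j) ∈ R`. -/
def DetailedBalanced {V : Type*} (R : V → V → Prop) (r : V → V → ℝ≥0) : Prop :=
  ∀ i j, R i j → r i j = r j i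

/-- `r` is complex-balanced: for every vertex, the sums of outgoing and incoming rates agree. -/
def ComplexBalanced {V : Type*} [Fintype V] (R : V → V → Prop) [DecidableRel R]
    (r : V → V → ℝ≥0) : Prop :=
  ∀ i, ∑ j ∈ Finset.univ.filter (fun j => R i j), r i j
      = ∑ j ∈ Finset.univ.filter (fun j => R j i), r j i

/-- `r` is formally balanced: for every directed cycle, the products of forward
and backward rates agree. -/
def FormallyBalanced {V : Type*} (R : V → V → Prop) (r : V → V → ℝ≥0) : Prop :=
  ∀ (k : ℕ) (f : Fin k → V), IsDirCycle R f →
    ∏ l, r (f l) (f (cycNext l)) = ∏ l, r (f (cycNext l)) (f l)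

/-- `r` is strongly cycle-balanced: for every directed cycle, either all edges have equal
forward and backward rates, or there are both an edge with strictly smaller forward rate
and an edge with strictly larger forward rate. -/
def StronglyCycleBalanced {V : Type*} (R : V → V → Prop) (r : V → V → ℝ≥0) : Prop :=
  ∀ (k : ℕ) (f : Fin k → V), IsDirCycle R f →
    (∀ l, r (f l) (f (cycNext l)) = r (f (cycNext l)) (f l)) ∨
    (∃ l l', r (f l) (f (cycNext l)) < r (f (cycNext l)) (f l) ∧
      r (f l') (f (cycNext l')) > r (f (cycNext l')) (f l'))

/-- `r` is cycle-balanced: for every directed cycle, there are (not necessarily distinct)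
edges with forward rate `≤` backward rate and with forward rate `≥` backward rate. -/
def CycleBalanced {V : Type*} (R : V → V → Prop) (r : V → V → ℝ≥0) : Prop :=
  ∀ (k : ℕ) (f : Fin k → V), IsDirCycle R f →
    ∃ l l', r (f l) (f (cycNext l)) ≤ r (f (cycNext l)) (f l) ∧
      r (f l') (f (cycNext l')) ≥ r (f (cycNext l')) (f l')

theorem cyc_prop {k : ℕ} (Q : Fin k → Prop) (h : ∀ l, Q l → Q (cycNext l)) (a : Fin k)
    (ha : Q a) (b : Fin k) : Q b := by
  have key : ∀ n : ℕ, Q ⟨(a.val + n) % k, Nat.mod_lt _ a.pos⟩ := by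
    intro n
    induction n with
    | zero =>
      have : (⟨(a.val + 0) % k, Nat.mod_lt _ a.pos⟩ : Fin k) = a := by
        ext; simp [Nat.mod_eq_of_lt a.isLt]
      rw [this]; exact ha
    | succ n ih =>
      have := h _ ih
      have e : cycNext (⟨(a.val + n) % k, Nat.mod_lt _ a.pos⟩ : Fin k)
          = ⟨(a.val + (n + 1)) % k, Nat.mod_lt _ a.pos⟩ := by
        ext; simp [cycNext, Nat.add_assoc]
      rw [e] at this; exact this
  have := key (b.val + k - a.val)
  have e : (⟨(a.val + (b.val + k - a.val)) % k, Nat.mod_lt _ a.pos⟩ : Fin k) = b := by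
    ext
    have h1 : a.val + (b.val + k - a.val) = b.val + k := by have := a.isLt; omega
    simp [h1, Nat.mod_eq_of_lt b.isLt]
  rw [e] at this; exact this

theorem prod_aux {k : ℕ} (a b : Fin k → ℝ≥0) (h : (∀ l, 0 < a l) ∨ (∀ l, b l = 0))
    (hle : ∀ l, a l ≤ b l) (hp : ∏ l, a l = ∏ l, b l) (l : Fin k) : a l = b l := by
  rcases h with h | h
  · by_contra hne
    have := Finset.prod_lt_prod (s := Finset.univ) (f := a) (g := b) (fun i _ => h i)
      (fun i _ => hle i) ⟨l, Finset.mem_univ _, lt_of_le_of_ne (hle l) hne⟩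
    exact absurd hp this.ne
  · have := hle l
    rw [h l] at this ⊢
    exact le_antisymm this zero_le

/-- If the positivity of each rate is determined by its source vertex,
then formal balance implies strong cycle balance. -/
theorem stmt_11 {V : Type*} [Fintype V] (R : V → V → Prop) [DecidableRel R]
    (hR_irrefl : ∀ i, ¬ R i i) (hR_symm : ∀ i j, R i j → R j i)
    (r : V → V → ℝ≥0)
    (hsupp : ∃ P : Set V, ∀ i j, R i j → (0 < r i j ↔ i ∈ P))
    (hFB : FormallyBalanced R r) :
    StronglyCycleBalanced R r := by
  obtain ⟨P, hP⟩ := hsupp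
  intro k f hf
  have hp := hFB k f hf
  obtain ⟨-, -, hR⟩ := hf
  have hA : ∀ l, 0 < r (f l) (f (cycNext l)) ↔ f l ∈ P := fun l => hP _ _ (hR l)
  have hB : ∀ l, 0 < r (f (cycNext l)) (f l) ↔ f (cycNext l) ∈ P :=
    fun l => hP _ _ (hR_symm _ _ (hR l))
  by_cases h1 : ∃ l, r (f l) (f (cycNext l)) < r (f (cycNext l)) (f l)
  · by_cases h2 : ∃ l, r (f l) (f (cycNext l)) > r (f (cycNext l)) (f l)
    · obtain ⟨l, hl⟩ := h1
      obtain ⟨l', hl'⟩ := h2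
      exact Or.inr ⟨l, l', hl, hl'⟩
    · left
      push Not at h2
      refine prod_aux _ _ ?_ h2 hp
      have st : ∀ l, f l ∈ P → f (cycNext l) ∈ P :=
        fun l hl => (hB l).1 (lt_of_lt_of_le ((hA l).2 hl) (h2 l))
      by_cases hx : ∃ l, f l ∈ P
      · obtain ⟨x, hx⟩ := hx
        exact Or.inl fun l => (hA l).2 (cyc_prop (fun l => f l ∈ P) st x hx l)
      · push Not at hx
        exact Or.inr fun l => by
          by_contra h0
          exact hx _ ((hB l).1 (pos_iff_ne_zero.2 h0))
  · left
    push Not at h1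
    intro l
    refine (prod_aux _ _ ?_ h1 hp.symm l).symm
    have st : ∀ l, f l ∉ P → f (cycNext l) ∉ P :=
      fun l hl h => hl ((hA l).1 (lt_of_lt_of_le ((hB l).2 h) (h1 l)))
    by_cases hx : ∃ l, f l ∉ P
    · obtain ⟨x, hx⟩ := hx
      exact Or.inr fun l => by
        by_contra h0
        exact cyc_prop (fun l => f l ∉ P) st x hx l ((hA l).1 (pos_iff_ne_zero.2 h0))
    · push Not at hx
      exact Or.inl fun l => (hB l).2 (hx _)
end

section
/- Let V be a finite set, R an irreflexive symmetric relation on V, and r : V × V → ℝ≥0. If r is complex-balanced (CB) and cycle-balanced (CycB), then r is detailed-balanced (DB). -/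
open scoped NNReal

/-- Complex balance and cycle balance imply detailed balance. -/
theorem stmt_14 {V : Type*} [Fintype V] (R : V → V → Prop) [DecidableRel R]
    (hR_irrefl : ∀ i, ¬ R i i) (hR_symm : ∀ i j, R i j → R j i)
    (r : V → V → ℝ≥0)
    (hCB : ComplexBalanced R r) (hCycB : CycleBalanced R r) :
    DetailedBalanced R r := by
  intro i j hij
  by_contra hne
  have step : ∀ i j, (R i j ∧ r j i < r i j) → ∃ k, R j k ∧ r k j < r j k := by
    intro i j ⟨hij, hlt⟩
    by_contra hcon
    push Not at hcon
    have h := hCB j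
    have hf : Finset.univ.filter (fun k => R k j) = Finset.univ.filter (fun k => R j k) := by
      ext k
      simp only [Finset.mem_filter, Finset.mem_univ, true_and]
      exact ⟨hR_symm _ _, hR_symm _ _⟩
    rw [hf] at h
    refine absurd h (ne_of_lt (Finset.sum_lt_sum ?_ ⟨i, ?_, hlt⟩))
    · intro k hk
      exact hcon k (by simpa using hk)
    · simpa using hR_symm _ _ hij
  obtain ⟨a, b, hab⟩ : ∃ a b, R a b ∧ r b a < r a b := by
    rcases lt_or_gt_of_ne hne with h | h
    · exact ⟨j, i, hR_symm _ _ hij, h⟩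
    · exact ⟨i, j, hij, h⟩
  let T := {v : V // ∃ u, R u v ∧ r v u < r u v}
  have hT : ∀ t : T, ∃ t' : T, R t.1 t'.1 ∧ r t'.1 t.1 < r t.1 t'.1 := by
    rintro ⟨v, u, hu⟩
    obtain ⟨k, hk⟩ := step u v hu
    exact ⟨⟨k, v, hk⟩, hk⟩
  choose g hg using hT
  let x : ℕ → V := fun n => (g^[n] ⟨b, a, hab⟩).1
  have hx : ∀ n, R (x n) (x (n + 1)) ∧ r (x (n + 1)) (x n) < r (x n) (x (n + 1)) := by
    intro n
    simp only [x, Function.iterate_succ_apply']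
    exact hg _
  clear_value x
  have hex : ∃ k, 0 < k ∧ ∃ m, x (m + k) = x m := by
    obtain ⟨p, q, hpq, he⟩ := Finite.exists_ne_map_eq_of_infinite x
    rcases lt_or_gt_of_ne hpq with h | h
    · exact ⟨q - p, by omega, p, by rw [show p + (q - p) = q by omega, he]⟩
    · exact ⟨p - q, by omega, q, by rw [show q + (p - q) = p by omega, he]⟩
  classical
  obtain ⟨hk0, m, hm⟩ := Nat.find_spec hex
  have hmin : ∀ c, c < Nat.find hex → 0 < c → ∀ m, x (m + c) ≠ x m := by
    intro c hc h0 m h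
    exact Nat.find_min hex hc ⟨h0, m, h⟩
  generalize Nat.find hex = k at *
  have hnext : ∀ l : Fin k, x (m + (cycNext l).val) = x (m + l.val + 1) := by
    intro l
    have hl := l.isLt
    simp only [cycNext]
    by_cases h : l.val + 1 < k
    · rw [Nat.mod_eq_of_lt h]; rfl
    · have h' : l.val + 1 = k := by omega
      rw [h', Nat.mod_self, add_assoc, h', hm]; rfl
  have hcyc : IsDirCycle R (fun l : Fin k => x (m + l.val)) := by
    refine ⟨?_, ?_, ?_⟩
    · by_contra hlt
      have h2 : k = 1 ∨ k = 2 := by omega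
      rcases h2 with rfl | rfl
      · have := (hx m).1
        rw [hm] at this
        exact hR_irrefl _ this
      · have h1 := (hx m).2
        have h2 := (hx (m + 1)).2
        rw [show m + 1 + 1 = m + 2 from rfl, hm] at h2
        exact lt_asymm h1 h2
    · intro p q hpq
      have hp := p.isLt
      have hq := q.isLt
      simp only at hpq
      by_contra hne
      rcases lt_or_gt_of_ne (fun h => hne (Fin.ext h) : p.val ≠ q.val) with h | h
      · refine hmin (q.val - p.val) (by omega) (by omega) (m + p.val) ?_
        rw [show m + p.val + (q.val - p.val) = m + q.val by omega, hpq]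
      · refine hmin (p.val - q.val) (by omega) (by omega) (m + q.val) ?_
        rw [show m + q.val + (p.val - q.val) = m + p.val by omega, hpq]
    · intro l
      simp only [hnext]
      exact (hx _).1
  obtain ⟨l, -, h, -⟩ := hCycB k _ hcyc
  simp only [hnext] at h
  exact absurd (hx (m + l.val)).2 (not_lt.mpr h)
end

section
/- Let V be a finite set, R an irreflexive symmetric relation on V, and r : V × V → ℝ≥0. If r is complex-balanced (CB), then the following are equivalent: (i) r is detailed-balanced (DB); (ii) r is formally balanced (FB); (iii) r is strongly cycle-balanced (sCycB); (iv) r is cycle-balanced (CycB). -/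
open scoped NNReal

theorem aux_prod_lt {k : ℕ} (hk : 3 ≤ k) (a b : Fin k → ℝ≥0) (h : ∀ l, a l < b l) :
    ∏ l, a l < ∏ l, b l := by
  have hb : 0 < ∏ l, b l := Finset.prod_pos (fun l _ => lt_of_le_of_lt zero_le (h l))
  by_cases h0 : ∃ l, a l = 0
  · obtain ⟨l, hl⟩ := h0
    rw [Finset.prod_eq_zero (Finset.mem_univ l) hl]
    exact hb
  · push Not at h0
    exact Finset.prod_lt_prod_of_nonempty (fun l _ => pos_iff_ne_zero.mpr (h0 l))
      (fun l _ => h l) ⟨⟨0, by omega⟩, Finset.mem_univ _⟩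

theorem aux_cycle {V : Type*} [Finite V] (S : V → V → Prop)
    (hasym : ∀ x y, S x y → ¬ S y x) (a : ℕ → V) (ha : ∀ n, S (a n) (a (n+1))) :
    ∃ (k : ℕ) (f : Fin k → V), IsDirCycle S f := by
  classical
  have hex : ∃ k, 0 < k ∧ ∃ m, a m = a (m + k) := by
    obtain ⟨x, y, hne, hxy⟩ := Finite.exists_ne_map_eq_of_infinite a
    rcases lt_or_gt_of_ne hne with h | h
    · exact ⟨y - x, by omega, x, by rw [hxy]; congr 1; omega⟩
    · exact ⟨x - y, by omega, y, by rw [← hxy]; congr 1; omega⟩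
  obtain ⟨hpos, m, hm⟩ := Nat.find_spec hex
  have hmin : ∀ k, k < Nat.find hex → ¬ (0 < k ∧ ∃ m, a m = a (m + k)) :=
    fun k hk => Nat.find_min hex hk
  generalize Nat.find hex = k at hpos hm hmin
  refine ⟨k, fun l => a (m + l), ?_, ?_, ?_⟩
  · by_contra hlt
    have h12 : k = 1 ∨ k = 2 := by omega
    rcases h12 with rfl | rfl
    · have := ha m
      rw [← hm] at this
      exact hasym _ _ this this
    · have h1 := ha m
      have h2 := ha (m+1)
      rw [show m + 1 + 1 = m + 2 from rfl, ← hm] at h2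
      exact hasym _ _ h1 h2
  · intro x y hxy
    have hxy : a (m + x) = a (m + y) := hxy
    have hx := x.2
    have hy := y.2
    by_contra hne
    have hne : (x : ℕ) ≠ y := fun h => hne (Fin.ext h)
    rcases lt_or_gt_of_ne hne with h | h
    · exact hmin (y - x) (by omega) ⟨by omega, m + x, by rw [hxy]; congr 1; omega⟩
    · exact hmin (x - y) (by omega) ⟨by omega, m + y, by rw [← hxy]; congr 1; omega⟩
  · intro l
    have hl := l.2
    have h := ha (m + l)
    show S (a (m + l)) (a (m + ((l.val + 1) % k)))
    by_cases he : l.val + 1 = k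
    · rw [he, Nat.mod_self, add_zero, hm]
      rwa [add_assoc, he] at h
    · rw [Nat.mod_eq_of_lt (by omega)]
      exact h

theorem aux_next {V : Type*} [Fintype V] (R : V → V → Prop) [DecidableRel R]
    (hR_symm : ∀ i j, R i j → R j i) (r : V → V → ℝ≥0) (hCB : ComplexBalanced R r)
    (i j : V) (hR : R i j) (hr : r j i < r i j) : ∃ l, R j l ∧ r l j < r j l := by
  by_contra hcon
  push Not at hcon
  have h := hCB j
  have hf : Finset.univ.filter (fun l => R l j) = Finset.univ.filter (fun l => R j l) := by
    ext l
    simp only [Finset.mem_filter, Finset.mem_univ, true_and]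
    exact ⟨hR_symm _ _, hR_symm _ _⟩
  rw [hf] at h
  refine absurd h (ne_of_lt (Finset.sum_lt_sum ?_ ⟨i, ?_, hr⟩))
  · intro l hl
    exact hcon l (Finset.mem_filter.mp hl).2
  · simp [hR_symm _ _ hR]

/-- Given complex balance, detailed balance, formal balance, strong cycle balance,
and cycle balance are all equivalent. -/
theorem stmt_15 {V : Type*} [Fintype V] (R : V → V → Prop) [DecidableRel R]
    (hR_irrefl : ∀ i, ¬ R i i) (hR_symm : ∀ i j, R i j → R j i)
    (r : V → V → ℝ≥0)
    (hCB : ComplexBalanced R r) :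
    List.TFAE [DetailedBalanced R r, FormallyBalanced R r,
      StronglyCycleBalanced R r, CycleBalanced R r] := by
  tfae_have 1 → 2 := by
    intro h k f hf
    exact Finset.prod_congr rfl (fun l _ => h _ _ (hf.2.2 l))
  tfae_have 1 → 3 := by
    intro h k f hf
    exact Or.inl (fun l => h _ _ (hf.2.2 l))
  tfae_have 3 → 4 := by
    intro h k f hf
    have hk := hf.1
    rcases h k f hf with h | ⟨l, l', h1, h2⟩
    · exact ⟨⟨0, by omega⟩, ⟨0, by omega⟩, (h _).le, (h _).ge⟩
    · exact ⟨l, l', h1.le, h2.le⟩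
  tfae_have 2 → 4 := by
    intro h k f hf
    have hp := h k f hf
    have h1 : ∃ l, r (f l) (f (cycNext l)) ≤ r (f (cycNext l)) (f l) := by
      by_contra hc
      push Not at hc
      exact (aux_prod_lt hf.1 _ _ hc).ne' hp
    have h2 : ∃ l, r (f (cycNext l)) (f l) ≤ r (f l) (f (cycNext l)) := by
      by_contra hc
      push Not at hc
      exact (aux_prod_lt hf.1 _ _ hc).ne hp
    obtain ⟨l, hl⟩ := h1
    obtain ⟨l', hl'⟩ := h2
    exact ⟨l, l', hl, hl'⟩
  tfae_have 4 → 1 := by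
    intro h
    have key : ∀ i j, R i j → ¬ r j i < r i j := by
      intro i j hR hr
      let T := {p : V × V // R p.1 p.2 ∧ r p.2 p.1 < r p.1 p.2}
      have hn : ∀ p : T, ∃ q : T, q.1.1 = p.1.2 := by
        rintro ⟨⟨x, y⟩, h1, h2⟩
        obtain ⟨l, hl1, hl2⟩ := aux_next R hR_symm r hCB x y h1 h2
        exact ⟨⟨(y, l), hl1, hl2⟩, rfl⟩
      choose g hg using hn
      let s : ℕ → T := fun n => g^[n] ⟨(i, j), hR, hr⟩
      have hs : ∀ n, (s (n+1)).1.1 = (s n).1.2 := by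
        intro n
        simp only [s, Function.iterate_succ_apply']
        exact hg _
      obtain ⟨k, f, hk, hinj, hf⟩ := aux_cycle (fun x y => R x y ∧ r y x < r x y)
        (fun x y h1 h2 => lt_asymm h1.2 h2.2) (fun n => (s n).1.1)
        (fun n => by
          have := (s n).2
          rw [← hs n] at this
          exact this)
      obtain ⟨l, _, hl, _⟩ := h k f ⟨hk, hinj, fun l => (hf l).1⟩
      exact absurd (hf l).2 (not_lt.mpr hl)
    intro i j hR
    exact le_antisymm (not_lt.mp (key i j hR)) (not_lt.mp (key j i (hR_symm _ _ hR)))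
  tfae_finish
end

section
/- Let V be a finite set, R an irreflexive symmetric relation on V, and r : V × V → ℝ≥0. If r is weakly complex-balanced (wCB), i.e., the induced mixed graph G_r is vertex-balanced, and r is cycle-balanced (CycB), then r is detailed-balanced (DB). -/
open scoped NNReal

/-- Weak complex balance (vertex balance of the induced graph) and cycle balance
imply detailed balance. -/
theorem stmt_16 {V : Type*} [Fintype V] (R : V → V → Prop) [DecidableRel R]
    (hR_irrefl : ∀ i, ¬ R i i) (hR_symm : ∀ i j, R i j → R j i)
    (r : V → V → ℝ≥0)
    (hwCB : ∀ i, (∃ j, R j i ∧ r j i > r i j) ↔ (∃ j', R i j' ∧ r i j' > r j' i))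
    (hCycB : CycleBalanced R r) :
    DetailedBalanced R r := by
  by_contra hDB
  have hex : ∃ a b, R a b ∧ r a b > r b a := by
    unfold DetailedBalanced at hDB
    push Not at hDB
    obtain ⟨i, j, hij, hne⟩ := hDB
    rcases lt_or_gt_of_ne hne with h | h
    · exact ⟨j, i, hR_symm _ _ hij, h⟩
    · exact ⟨i, j, hij, h⟩
  obtain ⟨a, b, hab⟩ := hex
  have hstep : ∀ x : {x : V // ∃ j, R j x ∧ r j x > r x j},
      ∃ y : {x : V // ∃ j, R j x ∧ r j x > r x j}, R x.1 y.1 ∧ r x.1 y.1 > r y.1 x.1 := by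
    rintro ⟨x, hx⟩
    obtain ⟨y, hy⟩ := (hwCB x).1 hx
    exact ⟨⟨y, x, hy⟩, hy⟩
  choose g hg using hstep
  obtain ⟨u, hu⟩ : ∃ u : ℕ → V, ∀ n, R (u n) (u (n+1)) ∧ r (u n) (u (n+1)) > r (u (n+1)) (u n) := by
    refine ⟨fun n => (g^[n] ⟨b, a, hab⟩).1, fun n => ?_⟩
    simp only [Function.iterate_succ_apply']
    exact hg _
  have hP : ∃ d, 0 < d ∧ ∃ i, u i = u (i + d) := by
    obtain ⟨i, j, hne, he⟩ := Finite.exists_ne_map_eq_of_infinite u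
    rcases lt_or_gt_of_ne hne with h | h
    · exact ⟨j - i, by omega, i, by rw [he]; congr 1; omega⟩
    · exact ⟨i - j, by omega, j, by rw [← he]; congr 1; omega⟩
  classical
  obtain ⟨hd, i, hi⟩ := Nat.find_spec hP
  have hmin : ∀ m, m < Nat.find hP → ¬ (0 < m ∧ ∃ i, u i = u (i + m)) :=
    fun m hm => Nat.find_min hP hm
  generalize Nat.find hP = d at hd hi hmin
  have hnext : ∀ l : Fin d, u (i + (cycNext l).val) = u (i + l.val + 1) := by
    intro l
    have hl := l.2
    by_cases h : l.val + 1 = d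
    · simp only [cycNext, h, Nat.mod_self, Nat.add_zero, hi, Nat.add_assoc]
    · have : (l.val + 1) % d = l.val + 1 := Nat.mod_eq_of_lt (by omega)
      simp only [cycNext, this, Nat.add_assoc]
  have hcyc : IsDirCycle R (fun l : Fin d => u (i + l.val)) := by
    refine ⟨?_, ?_, ?_⟩
    · by_contra hlt
      have h12 : d = 1 ∨ d = 2 := by omega
      rcases h12 with rfl | rfl
      · have := (hu i).1
        rw [← hi] at this
        exact hR_irrefl _ this
      · have h1 := (hu i).2
        have h2 := (hu (i+1)).2
        have h3 : u (i + 1 + 1) = u i := hi.symm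
        rw [h3] at h2
        exact lt_asymm h1 h2
    · have key : ∀ p q : Fin d, p.val < q.val → u (i + p.val) ≠ u (i + q.val) := by
        intro p q hpq he
        refine hmin (q.val - p.val) (by omega) ⟨by omega, i + p.val, ?_⟩
        rw [he]; congr 1; omega
      intro p q he
      rcases lt_trichotomy p.val q.val with h | h | h
      · exact absurd he (key p q h)
      · exact Fin.ext h
      · exact absurd he.symm (key q p h)
    · intro l
      simp only [hnext]
      exact (hu _).1
  obtain ⟨l, -, hl, -⟩ := hCycB d _ hcyc
  simp only [hnext] at hl
  exact absurd (hu (i + l.val)).2 (not_lt.mpr hl)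
end

section
/- Let V be a countable set, q : V × V → ℝ≥0 with q(x,x) = 0 for all x and q(x,y) > 0 if and only if q(y,x) > 0, and let μ : V → ℝ≥0 be a stationary measure (assume that for each x the families (μ(x)q(x,y))_y and (μ(y)q(y,x))_y are summable and have equal sums). If the induced mixed graph G_μ contains no directed cycle and no bi-infinite directed path, then μ is reversible: μ(x)q(x,y) = μ(y)q(y,x) for all x, y ∈ V. -/
open scoped NNReal

theorem cyc_or_inj {V : Type*} (D : V → V → Prop) (hasym : ∀ x y, D x y → ¬ D y x)
    (f : ℤ → V) (hf : ∀ n, D (f n) (f (n + 1))) (hni : ¬ Function.Injective f) :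
    HasDirectedCycle D := by
  classical
  have hex : ∃ k : ℕ, 0 < k ∧ ∃ i : ℤ, f i = f (i + k) := by
    simp only [Function.Injective, not_forall] at hni
    obtain ⟨a, b, hab, hne⟩ := hni
    rcases lt_or_gt_of_ne hne with h | h
    · exact ⟨(b - a).toNat, by omega, a, by rw [hab]; congr 1; omega⟩
    · exact ⟨(a - b).toNat, by omega, b, by rw [← hab]; congr 1; omega⟩
  obtain ⟨hk0, i, hi⟩ := Nat.find_spec hex
  have hmin : ∀ m, m < Nat.find hex → ¬ _ := fun m hm => Nat.find_min hex hm
  generalize Nat.find hex = k at *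
  have hlt : ∀ l m : ℕ, l < m → m < k → f (i + l) ≠ f (i + m) := by
    intro l m hlm hm h
    refine hmin (m - l) (by omega) ⟨by omega, i + l, ?_⟩
    rw [h]; congr 1; omega
  refine ⟨k, fun l => f (i + (l.val : ℤ)), ?_, ?_, ?_⟩
  · by_contra h
    have : k = 1 ∨ k = 2 := by omega
    rcases this with rfl | rfl
    · have h1 := hf i
      simp only [Nat.cast_one] at hi
      rw [← hi] at h1
      exact hasym _ _ h1 h1
    · have h1 := hf i
      have h2 := hf (i + 1)
      have h3 : i + 1 + 1 = i + ((2 : ℕ) : ℤ) := by push_cast; ring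
      rw [h3, ← hi] at h2
      exact hasym _ _ h1 h2
  · intro l m h
    rcases lt_trichotomy l.val m.val with h1 | h1 | h1
    · exact absurd h (hlt _ _ h1 m.2)
    · exact Fin.ext h1
    · exact absurd h.symm (hlt _ _ h1 l.2)
  · intro l
    have h1 := hf (i + (l.val : ℤ))
    simp only [cycNext]
    by_cases h : l.val + 1 = k
    · have h2 : (l.val + 1) % k = 0 := by rw [h]; exact Nat.mod_self k
      rw [h2]
      have h3 : i + (l.val : ℤ) + 1 = i + (k : ℤ) := by omega
      rw [h3, ← hi] at h1
      simpa using h1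
    · have h2 : (l.val + 1) % k = l.val + 1 := Nat.mod_eq_of_lt (by have := l.2; omega)
      rw [h2]
      push_cast
      rw [← add_assoc]
      exact h1

theorem exists_bi {V : Type*} (D : V → V → Prop)
    (hs : ∀ x y, D x y → ∃ z, D y z) (hp : ∀ x y, D x y → ∃ z, D z x)
    (x y : V) (hxy : D x y) : ∃ f : ℤ → V, ∀ n, D (f n) (f (n + 1)) := by
  have hs' : ∀ y, ∃ z, (∃ x, D x y) → D y z := by
    intro y
    by_cases h : ∃ x, D x y
    · obtain ⟨x, hx⟩ := h
      obtain ⟨z, hz⟩ := hs x y hx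
      exact ⟨z, fun _ => hz⟩
    · exact ⟨y, fun h' => absurd h' h⟩
  have hp' : ∀ x, ∃ z, (∃ y, D x y) → D z x := by
    intro x
    by_cases h : ∃ y, D x y
    · obtain ⟨y, hy⟩ := h
      obtain ⟨z, hz⟩ := hp x y hy
      exact ⟨z, fun _ => hz⟩
    · exact ⟨x, fun h' => absurd h' h⟩
  choose s hs using hs'
  choose p hp using hp'
  have ha : ∀ n : ℕ, D (s^[n] y) (s^[n + 1] y) := by
    intro n
    induction n with
    | zero => exact hs y ⟨x, hxy⟩
    | succ n ih =>
      rw [Function.iterate_succ_apply' s (n + 1)]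
      exact hs _ ⟨_, ih⟩
  have hb : ∀ n : ℕ, D (p^[n + 1] x) (p^[n] x) := by
    intro n
    induction n with
    | zero => exact hp x ⟨y, hxy⟩
    | succ n ih =>
      rw [Function.iterate_succ_apply' p (n + 1)]
      exact hp _ ⟨_, ih⟩
  refine ⟨fun n => match n with
    | Int.ofNat n => s^[n] y
    | Int.negSucc n => p^[n] x, ?_⟩
  intro n
  match n with
  | Int.ofNat n => exact ha n
  | Int.negSucc 0 => exact hxy
  | Int.negSucc (n + 1) => exact hb n

theorem exists_gt_of {V : Type*} (a b : V → ℝ≥0) (ha : Summable a) (hb : Summable b)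
    (h : ∑' y, a y = ∑' y, b y) (x : V) (hx : a x < b x) : ∃ z, b z < a z := by
  by_contra! hc
  exact absurd h (ne_of_lt (NNReal.tsum_lt_tsum hc hx hb))

/-- For a continuous-time Markov chain with symmetric transition structure and a
stationary measure `μ`: if the induced mixed graph contains no directed cycle and
no bi-infinite directed path, then `μ` is reversible. -/
theorem stmt_17 {V : Type*} [Countable V] (q : V → V → ℝ≥0) (μ : V → ℝ≥0)
    (hq_irrefl : ∀ x, q x x = 0)
    (hq_symm : ∀ x y, 0 < q x y ↔ 0 < q y x)
    (hsum_out : ∀ x, Summable (fun y => μ x * q x y))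
    (hsum_in : ∀ x, Summable (fun y => μ y * q y x))
    (hstationary : ∀ x, ∑' y, μ x * q x y = ∑' y, μ y * q y x)
    (h_no_cycle :
      ¬ HasDirectedCycle (fun x y => 0 < q x y ∧ μ x * q x y > μ y * q y x))
    (h_no_path :
      ¬ HasBiInfiniteDirectedPath (fun x y => 0 < q x y ∧ μ x * q x y > μ y * q y x)) :
    ∀ x y, μ x * q x y = μ y * q y x := by
  have hD : ∀ x y, μ x * q x y > μ y * q y x → 0 < q x y ∧ μ x * q x y > μ y * q y x := by
    intro x y h
    refine ⟨pos_iff_ne_zero.2 fun h0 => ?_, h⟩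
    rw [h0, mul_zero] at h
    exact not_lt_zero h
  have key : ∀ x y, ¬ (μ x * q x y > μ y * q y x) := by
    intro x y hxy
    obtain ⟨f, hf⟩ := exists_bi (fun x y => 0 < q x y ∧ μ x * q x y > μ y * q y x)
      (fun x y h => by
        obtain ⟨z, hz⟩ := exists_gt_of _ _ (hsum_out y) (hsum_in y) (hstationary y) x h.2
        exact ⟨z, hD _ _ hz⟩)
      (fun x y h => by
        obtain ⟨z, hz⟩ := exists_gt_of _ _ (hsum_in x) (hsum_out x) (hstationary x).symm y h.2
        exact ⟨z, hD _ _ hz⟩) x y (hD x y hxy)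
    by_cases hi : Function.Injective f
    · exact h_no_path ⟨f, hi, hf⟩
    · exact h_no_cycle (cyc_or_inj _ (fun a b h1 h2 => lt_asymm h1.2 h2.2) f hf hi)
  intro x y
  exact le_antisymm (not_lt.1 (key x y)) (not_lt.1 (key y x))
end
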